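/- Let n ≥ 2 and I = {i} be a singleton. Then there exists a real number α ≠ 0 such that (I − cP)^{−1} e_i = α · (I − cP_0)^{−1} e_i. As a consequence, the set of nodes j ≠ i maximizing v_j equals the set of nodes j ≠ i maximizing (v_0)_j. -/

import Mathlib

open Matrix Finset

/-- Outdegree of node `i` in the edge set `E`. -/
def outdeg {n : ℕ} (E : Finset (Fin n × Fin n)) (i : Fin n) : ℕ :=
  (Finset.univ.filter (fun j => (i, j) ∈ E)).card

/-- The scaled adjacency matrix `P` of the graph: `P i j = 1 / outdeg i` if `(i,j) ∈ E`. -/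
noncomputable def Pmat {n : ℕ} (E : Finset (Fin n × Fin n)) : Matrix (Fin n) (Fin n) ℝ :=
  fun i j => if (i, j) ∈ E then ((outdeg E i : ℝ))⁻¹ else 0

/-- Indicator vector of a set of nodes. -/
def ind {n : ℕ} (I : Finset (Fin n)) : Fin n → ℝ :=
  fun i => if i ∈ I then 1 else 0

/-- `v = (Id - cP)⁻¹ e_I`, the vector of mean numbers of visits to `I` before zapping. -/
noncomputable def vvec {n : ℕ} (c : ℝ) (E : Finset (Fin n × Fin n)) (I : Finset (Fin n)) : Fin n → ℝ :=
  (1 - c • Pmat E)⁻¹ *ᵥ ind I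

/-- PageRank vector `πᵀ = (1-c) zᵀ (Id - cP)⁻¹`. -/
noncomputable def pr {n : ℕ} (c : ℝ) (z : Fin n → ℝ) (E : Finset (Fin n × Fin n)) : Fin n → ℝ :=
  (1 - c) • (((1 - c • Pmat E)⁻¹)ᵀ *ᵥ z)

/-- PageRank of the set `I`: `πᵀ e_I`. -/
noncomputable def prSet {n : ℕ} (c : ℝ) (z : Fin n → ℝ) (E : Finset (Fin n × Fin n))
    (I : Finset (Fin n)) : ℝ :=
  ∑ i ∈ I, pr c z E i

/-- Node `i` has access to (some node of) the set `J`: `i ∈ J` or a directed path from `i`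
reaches `J`. -/
def access {n : ℕ} (E : Finset (Fin n × Fin n)) (i : Fin n) (J : Finset (Fin n)) : Prop :=
  ∃ j ∈ J, Relation.ReflTransGen (fun a b => (a, b) ∈ E) i j

lemma Pmat_nonneg {n : ℕ} (E : Finset (Fin n × Fin n)) (a b : Fin n) : 0 ≤ Pmat E a b := by
  unfold Pmat
  split_ifs
  · positivity
  · exact le_rfl

lemma Pmat_sum {n : ℕ} (E : Finset (Fin n × Fin n)) (hE : ∀ i, 0 < outdeg E i) (a : Fin n) :
    ∑ b, Pmat E a b = 1 := by
  unfold Pmat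
  rw [← Finset.sum_filter, Finset.sum_const, nsmul_eq_mul]
  have h : (0 : ℝ) < outdeg E a := by exact_mod_cast hE a
  exact mul_inv_cancel₀ h.ne'

lemma A_apply {n : ℕ} (c : ℝ) (E : Finset (Fin n × Fin n)) (w : Fin n → ℝ) (a : Fin n) :
    ((1 - c • Pmat E) *ᵥ w) a = w a - c * ∑ b, Pmat E a b * w b := by
  rw [Matrix.sub_mulVec, Matrix.one_mulVec, Matrix.smul_mulVec]
  simp [Matrix.mulVec, dotProduct]

lemma max_principle {n : ℕ} (E : Finset (Fin n × Fin n)) (hE : ∀ i, 0 < outdeg E i)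
    (c : ℝ) (hc0 : 0 < c) (hc1 : c < 1) (w : Fin n → ℝ)
    (h : ∀ a, 0 ≤ ((1 - c • Pmat E) *ᵥ w) a) (a : Fin n) : 0 ≤ w a := by
  obtain ⟨j, -, hj⟩ := Finset.exists_min_image Finset.univ w ⟨a, Finset.mem_univ a⟩
  refine le_trans ?_ (hj a (Finset.mem_univ a))
  have h1 := h j
  rw [A_apply] at h1
  have h2 : w j ≤ ∑ b, Pmat E j b * w b := by
    calc w j = ∑ b, Pmat E j b * w j := by rw [← Finset.sum_mul, Pmat_sum E hE, one_mul]
      _ ≤ _ := Finset.sum_le_sum fun b hb =>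
        mul_le_mul_of_nonneg_left (hj b hb) (Pmat_nonneg E j b)
  by_contra hneg
  push Not at hneg
  have h3 : 0 ≤ ∑ b, Pmat E j b * w b → False := fun h4 => by nlinarith
  nlinarith

lemma A_unit {n : ℕ} (E : Finset (Fin n × Fin n)) (hE : ∀ i, 0 < outdeg E i)
    (c : ℝ) (hc0 : 0 < c) (hc1 : c < 1) : IsUnit (1 - c • Pmat E) := by
  rw [← Matrix.mulVec_injective_iff_isUnit]
  intro x y hxy
  have key : ∀ x y : Fin n → ℝ, (1 - c • Pmat E) *ᵥ x = (1 - c • Pmat E) *ᵥ y →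
      ∀ a, y a ≤ x a := by
    intro x y hxy a
    have := max_principle E hE c hc0 hc1 (x - y) (by
      intro b; rw [Matrix.mulVec_sub, hxy]; simp) a
    simpa using this
  funext a
  exact le_antisymm (key y x hxy.symm a) (key x y hxy a)

lemma A_vvec {n : ℕ} (E : Finset (Fin n × Fin n)) (hE : ∀ i, 0 < outdeg E i)
    (c : ℝ) (hc0 : 0 < c) (hc1 : c < 1) (I : Finset (Fin n)) :
    (1 - c • Pmat E) *ᵥ vvec c E I = ind I := by
  have h := (Matrix.isUnit_iff_isUnit_det _).1 (A_unit E hE c hc0 hc1)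
  rw [vvec, Matrix.mulVec_mulVec, Matrix.mul_nonsing_inv _ h, Matrix.one_mulVec]

lemma vvec_pos {n : ℕ} (E : Finset (Fin n × Fin n)) (hE : ∀ i, 0 < outdeg E i)
    (c : ℝ) (hc0 : 0 < c) (hc1 : c < 1) (i : Fin n) : 0 < vvec c E {i} i := by
  have h := A_vvec E hE c hc0 hc1 {i}
  have hnn : ∀ a, 0 ≤ vvec c E {i} a := max_principle E hE c hc0 hc1 _ (by
    intro a; rw [h]; unfold ind; split_ifs <;> norm_num)
  have h1 := congrFun h i
  rw [A_apply] at h1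
  have h2 : 0 ≤ ∑ b, Pmat E i b * vvec c E {i} b :=
    Finset.sum_nonneg fun b _ => mul_nonneg (Pmat_nonneg E i b) (hnn b)
  have h3 := mul_nonneg hc0.le h2
  simp [ind] at h1
  linarith

lemma outdeg_abs {n : ℕ} (E : Finset (Fin n × Fin n)) (i a : Fin n) :
    outdeg ({(i, i)} ∪ E.filter (fun p => p.1 ≠ i)) a = if a = i then 1 else outdeg E a := by
  unfold outdeg
  split_ifs with h
  · subst h
    rw [Finset.card_eq_one]
    exact ⟨a, by ext; simp⟩
  · congr 1
    ext; simp [h]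

lemma Pmat_abs {n : ℕ} (E : Finset (Fin n × Fin n)) (i a b : Fin n) :
    Pmat ({(i, i)} ∪ E.filter (fun p => p.1 ≠ i)) a b =
      if a = i then (if b = i then 1 else 0) else Pmat E a b := by
  unfold Pmat
  rw [outdeg_abs]
  by_cases h : a = i <;> simp [h]

lemma vvec_abs {n : ℕ} (E : Finset (Fin n × Fin n))
    (hE : ∀ i, 0 < outdeg E i) (c : ℝ) (hc0 : 0 < c) (hc1 : c < 1) (i : Fin n) :
    vvec c E {i} = ((1 - c) * vvec c E {i} i) •
      vvec c ({(i, i)} ∪ E.filter (fun p => p.1 ≠ i)) {i} := by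
  have hE0 : ∀ a, 0 < outdeg ({(i, i)} ∪ E.filter (fun p => p.1 ≠ i)) a := by
    intro a; rw [outdeg_abs]; split_ifs
    · norm_num
    · exact hE a
  apply (Matrix.mulVec_injective_iff_isUnit.2 (A_unit _ hE0 c hc0 hc1))
  show _ *ᵥ _ = _ *ᵥ _
  rw [Matrix.mulVec_smul, A_vvec _ hE0 c hc0 hc1]
  funext a
  rw [A_apply]
  simp only [Pmat_abs]
  by_cases h : a = i
  · subst h
    simp [ind]
    ring
  · have := congrFun (A_vvec E hE c hc0 hc1 {i}) a
    rw [A_apply] at this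
    simp only [h, if_false, this]
    simp [ind, h]

/-- Lemma 9: for a singleton `I = {i}`, the vector `(Id - cP)⁻¹ e_i` is a nonzero scalar
multiple of the corresponding vector for the basic absorbing graph; consequently the set
of nodes `j ≠ i` maximizing `v` coincides with the one computed in the basic absorbing
graph (`V = V₀`). -/
theorem stmt10 {n : ℕ} (hn : 2 ≤ n) (E : Finset (Fin n × Fin n))
    (hE : ∀ i, 0 < outdeg E i) (c : ℝ) (hc0 : 0 < c) (hc1 : c < 1)
    (i : Fin n) :
    (∃ α : ℝ, α ≠ 0 ∧
      vvec c E {i} =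
        α • vvec c ({(i, i)} ∪ E.filter (fun p => p.1 ≠ i)) {i}) ∧
    {j : Fin n | j ≠ i ∧ ∀ k, k ≠ i → vvec c E {i} k ≤ vvec c E {i} j} =
      {j : Fin n | j ≠ i ∧ ∀ k, k ≠ i →
        vvec c ({(i, i)} ∪ E.filter (fun p => p.1 ≠ i)) {i} k ≤
          vvec c ({(i, i)} ∪ E.filter (fun p => p.1 ≠ i)) {i} j} := by
  have hv := vvec_abs E hE c hc0 hc1 i
  have hα : 0 < (1 - c) * vvec c E {i} i :=
    mul_pos (by linarith) (vvec_pos E hE c hc0 hc1 i)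
  generalize (1 - c) * vvec c E {i} i = α at hv hα
  refine ⟨⟨α, hα.ne', hv⟩, ?_⟩
  ext j
  rw [hv]
  simp only [Set.mem_setOf_eq, Pi.smul_apply, smul_eq_mul, mul_le_mul_iff_right₀ hα]
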